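/- For every real number t with 0 ≤ t < 1 and every real number b, one has (1−t)·∑_{k=0}^∞ t^k·(H_k + b)² = Li₂(t) + (b − ln(1−t))². -/

import Mathlib

/-- The `k`-th harmonic number `H_k = ∑_{j=1}^k 1/j`, with `H_0 = 0`. -/
noncomputable def H (k : ℕ) : ℝ := ∑ j ∈ Finset.range k, (1 : ℝ) / (j + 1)

/-- The dilogarithm `Li₂(t) = ∑_{k=1}^∞ t^k / k²`. -/
noncomputable def Li2 (t : ℝ) : ℝ := ∑' k : ℕ, t ^ (k + 1) / ((k : ℝ) + 1) ^ 2

/-- Abel summation for power series. -/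
theorem hasSum_pow_succ_mul_sub {t S : ℝ} {a : ℕ → ℝ} (h : HasSum (fun k ↦ t ^ k * a k) S) :
    HasSum (fun k ↦ t ^ (k + 1) * (a (k + 1) - a k)) ((1 - t) * S - a 0) := by
  have h1 := ((hasSum_nat_add_iff' 1).2 h).sub (h.mul_left t)
  simp only [Finset.sum_range_one, pow_zero, one_mul] at h1
  rw [show (1 - t) * S - a 0 = S - a 0 - t * S by ring]
  exact h1.congr_fun fun k ↦ by ring

theorem H_nonneg (k : ℕ) : 0 ≤ H k :=
  Finset.sum_nonneg fun _ _ ↦ by positivity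

theorem H_le (k : ℕ) : H k ≤ k := by
  have h : H k ≤ ∑ _j ∈ Finset.range k, (1 : ℝ) := by
    refine Finset.sum_le_sum fun j _ ↦ ?_
    rw [div_le_one (by positivity)]
    linarith [j.cast_nonneg (α := ℝ)]
  simpa using h

theorem H_succ (k : ℕ) : H (k + 1) = H k + 1 / (k + 1) := Finset.sum_range_succ _ _

theorem summable_pow_mul_H_add_sq {t : ℝ} (b : ℝ) (ht0 : 0 ≤ t) (ht1 : t < 1) :
    Summable fun k ↦ t ^ k * (H k + b) ^ 2 := by
  have ht : ‖t‖ < 1 := by rwa [Real.norm_of_nonneg ht0]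
  refine Summable.of_nonneg_of_le (fun k ↦ by positivity) (fun k ↦ ?_)
    (((summable_pow_mul_geometric_of_norm_lt_one 2 ht).mul_left 2).add
      ((summable_geometric_of_lt_one ht0 ht1).mul_left (2 * b ^ 2)))
  have h : (H k + b) ^ 2 ≤ 2 * (k : ℝ) ^ 2 + 2 * b ^ 2 := by
    nlinarith [sq_nonneg (H k - b), pow_le_pow_left₀ (H_nonneg k) (H_le k) 2]
  calc t ^ k * (H k + b) ^ 2 ≤ t ^ k * (2 * (k : ℝ) ^ 2 + 2 * b ^ 2) := by gcongr
    _ = _ := by ring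

theorem sum_one_div_mul_one_div_reflect (n : ℕ) :
    ∑ i ∈ Finset.range (n + 1), (1 / ((i : ℝ) + 1)) * (1 / (((n - i : ℕ) : ℝ) + 1))
      = 2 * H (n + 1) / (n + 2) := by
  have hr : ∑ i ∈ Finset.range (n + 1), 1 / (((n - i : ℕ) : ℝ) + 1) = H (n + 1) := by
    simpa [H] using Finset.sum_range_reflect (fun j : ℕ ↦ 1 / ((j : ℝ) + 1)) (n + 1)
  calc _ = ∑ i ∈ Finset.range (n + 1),
        (1 / ((i : ℝ) + 1) + 1 / (((n - i : ℕ) : ℝ) + 1)) / (n + 2) := by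
        refine Finset.sum_congr rfl fun i hi ↦ ?_
        have hn : (n : ℝ) = i + (n - i : ℕ) := by
          rw [← Nat.cast_add, Nat.add_sub_cancel' (Finset.mem_range_succ_iff.1 hi)]
        generalize n - i = m at hn ⊢
        rw [hn]
        field_simp
        ring
    _ = _ := by
        rw [← Finset.sum_div, Finset.sum_add_distrib, hr, two_mul]
        rfl

/-- The power series of `log (1 - t) ^ 2`. -/
theorem hasSum_pow_succ_mul_H_div {t : ℝ} (ht0 : 0 ≤ t) (ht1 : t < 1) :
    HasSum (fun k : ℕ ↦ 2 * (t ^ (k + 1) * H k / (k + 1))) (Real.log (1 - t) ^ 2) := by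
  have hL := Real.hasSum_pow_div_log_of_abs_lt_one (abs_lt.2 ⟨by linarith, ht1⟩)
  have hn := hL.summable.norm
  have hp := hasSum_sum_range_mul_of_summable_norm hn hn
  rw [hL.tsum_eq] at hp
  rw [← hasSum_nat_add_iff' 1]
  rw [show Real.log (1 - t) ^ 2 - ∑ i ∈ Finset.range 1, 2 * (t ^ (i + 1) * H i / ((i : ℝ) + 1))
    = -Real.log (1 - t) * -Real.log (1 - t) by simp [H]; ring]
  refine hp.congr_fun fun n ↦ ?_
  have hs : ∀ i ∈ Finset.range (n + 1),
      t ^ (i + 1) / ((i : ℝ) + 1) * (t ^ (n - i + 1) / (((n - i : ℕ) : ℝ) + 1))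
        = t ^ (n + 2) * ((1 / ((i : ℝ) + 1)) * (1 / (((n - i : ℕ) : ℝ) + 1))) := by
    intro i hi
    have hi' := Finset.mem_range_succ_iff.1 hi
    rw [show n + 2 = (i + 1) + (n - i + 1) by omega, pow_add t (i + 1)]
    ring
  rw [Finset.sum_congr rfl hs, ← Finset.mul_sum, sum_one_div_mul_one_div_reflect]
  push_cast
  ring

theorem summable_pow_succ_div_sq {t : ℝ} (ht0 : 0 ≤ t) (ht1 : t < 1) :
    Summable fun k : ℕ ↦ t ^ (k + 1) / ((k : ℝ) + 1) ^ 2 := by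
  refine Summable.of_nonneg_of_le (fun k ↦ by positivity) (fun k ↦ ?_)
    ((summable_nat_add_iff 1).2 (summable_geometric_of_lt_one ht0 ht1))
  exact div_le_self (by positivity) (one_le_pow₀ (by linarith [k.cast_nonneg (α := ℝ)]))

theorem stmt_4 (t b : ℝ) (ht0 : 0 ≤ t) (ht1 : t < 1) :
    (1 - t) * ∑' k : ℕ, t ^ k * (H k + b) ^ 2
      = Li2 t + (b - Real.log (1 - t)) ^ 2 := by
  have hA := hasSum_pow_succ_mul_sub (summable_pow_mul_H_add_sq b ht0 ht1).hasSum
  have hL := Real.hasSum_pow_div_log_of_abs_lt_one (abs_lt.2 ⟨by linarith, ht1⟩)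
  have hB := ((summable_pow_succ_div_sq ht0 ht1).hasSum.add (hL.mul_left (2 * b))).add
    (hasSum_pow_succ_mul_H_div ht0 ht1)
  have hAB := hA.unique (hB.congr_fun fun k ↦ by
    rw [H_succ]
    field_simp
    ring)
  have h0 : H 0 = 0 := Finset.sum_range_zero _
  rw [h0] at hAB
  unfold Li2
  linear_combination hAB
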